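/- arXiv:0809.5110 — 2 statements merged into one kernel-verified Lean document; each statement's English description precedes it below -/
import Mathlib

section
/- (Weighted sum formula, assuming the sum formula and the extended-double-shuffle vanishing as hypotheses.) Let ζ: {z-words z_{s1,...,sk} with s1 ≥ 2} → R be a Z-linear map to a commutative ring R such that (i) ζ kills all differences w1 ш w2 − w1 * w2 for z-words with first index ≥ 2, and all z_1 ш w − z_1 * w for such w, and (ii) ζ satisfies the sum formula: ∑_{s1 ≥ 2, si ≥ 1, ∑si = n} ζ(z_{s1,...,sk}) = ζ(z_n) for all k ≥ 1 and n ≥ k+1. Then for all k ≥ 2 and n ≥ k+1: ∑_{s1 ≥ 2, si ≥ 1, s1+...+sk = n} [C(s1,...,s_{k-1}) − C(s2,...,s_{k-1})] ζ(z_{s1,...,sk}) = n · ζ(z_n), with the convention C(∅) = 1. -/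
open Finsupp

/-- The free ℤ-module on words in the two letters `x₀, x₁`
(`false` plays the role of `x₀` and `true` the role of `x₁`). -/
abbrev XWords : Type := (List Bool) →₀ ℤ

/-- The free ℤ-module on words `z_{s₁,…,s_k}` (a word is the list of its indices). -/
abbrev QWords : Type := (List ℕ) →₀ ℤ

/-- A word in `x₀, x₁` as a basis element. -/
noncomputable def xw (l : List Bool) : XWords := Finsupp.single l 1

/-- The word `z_{s₁,…,s_k}` as a basis element. -/
noncomputable def zw (l : List ℕ) : QWords := Finsupp.single l 1

/-- The bijection `z_{s₁,…,s_k} ↔ x₀^{s₁-1} x₁ ⋯ x₀^{s_k-1} x₁` on words. -/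
def encodeWord : List ℕ → List Bool
  | [] => []
  | s :: t => List.replicate (s - 1) false ++ true :: encodeWord t

/-- Prepending the letter `z_r`, as a linear operator. -/
noncomputable def zcons (r : ℕ) : QWords →ₗ[ℤ] QWords :=
  Finsupp.lmapDomain ℤ ℤ (List.cons r)

/-- The coefficient `C(t₁,…,t_m) = ∑_{j=1}^{m} 2^{(t₁+⋯+t_j)-j} + 2^{(t₁+⋯+t_m)-m}`,
with `C` of the empty tuple equal to `1`. -/
def Ccoef (t : List ℕ) : ℤ :=
  (∑ j ∈ Finset.range t.length, 2 ^ ((t.take (j + 1)).sum - (j + 1)))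
    + 2 ^ (t.sum - t.length)

open Classical in
/-- Compositions of `n` with `k` parts and first part at least `2`. -/
noncomputable def admissibleWords (k n : ℕ) : Finset (List ℕ) :=
  (Finset.univ.filter
    (fun c : Composition n => c.length = k ∧ 2 ≤ c.blocks.headI)).image Composition.blocks

lemma mem_admissibleWords {k n : ℕ} {l : List ℕ} :
    l ∈ admissibleWords k n ↔
      (∀ x ∈ l, 1 ≤ x) ∧ l.sum = n ∧ l.length = k ∧ 2 ≤ l.headI := by
  simp only [admissibleWords, Finset.mem_image, Finset.mem_filter, Finset.mem_univ, true_and]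
  constructor
  · rintro ⟨c, ⟨hk, h2⟩, rfl⟩
    exact ⟨fun x hx => c.one_le_blocks hx, c.blocks_sum, hk, h2⟩
  · rintro ⟨hp, hs, hk, h2⟩
    exact ⟨⟨l, fun {i} hi => hp i hi, hs⟩, ⟨hk, h2⟩, rfl⟩

lemma sum_admissibleWords {M : Type*} [AddCommMonoid M] (k n : ℕ) (f : List ℕ → M) :
    ∑ l ∈ admissibleWords k n, f l =
      ∑ c ∈ Finset.univ.filter
        (fun c : Composition n => c.length = k ∧ 2 ≤ c.blocks.headI), f c.blocks := by
  classical
  rw [admissibleWords, Finset.sum_image]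
  intro c _ d _ h
  exact Composition.ext h

open Classical in
/-- Pairs of an index `r ≥ 1` and an admissible word of depth `k`, of total weight `n`. -/
noncomputable def admissiblePairs (k n : ℕ) : Finset (ℕ × List ℕ) :=
  (Finset.Icc 1 n ×ˢ (Finset.range (n + 1)).biUnion (admissibleWords k)).filter
    (fun p => p.1 + p.2.sum = n)

lemma mem_admissiblePairs {k n r : ℕ} {w : List ℕ} :
    (r, w) ∈ admissiblePairs k n ↔
      1 ≤ r ∧ (∀ x ∈ w, 1 ≤ x) ∧ 2 ≤ w.headI ∧ w.length = k ∧ r + w.sum = n := by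
  simp only [admissiblePairs, Finset.mem_filter, Finset.mem_product, Finset.mem_Icc,
    Finset.mem_biUnion, Finset.mem_range, mem_admissibleWords]
  constructor
  · rintro ⟨⟨⟨h1, -⟩, m, -, hp, -, hk, h2⟩, h⟩
    exact ⟨h1, hp, h2, hk, h⟩
  · rintro ⟨h1, hp, h2, hk, h⟩
    exact ⟨⟨⟨h1, by omega⟩, w.sum, by omega, hp, rfl, hk, h2⟩, h⟩

/-! ### Coefficients of the shuffle product -/

/-- The value of `f` summed over all ways of splitting a word into two complementary subwords. -/
def unshuffleSum (f : List Bool → List Bool → ℤ) : List Bool → ℤ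
  | [] => f [] []
  | a :: l => unshuffleSum (fun u v => f (a :: u) v) l + unshuffleSum (fun u v => f u (a :: v)) l

lemma unshuffleSum_congr {f g : List Bool → List Bool → ℤ} {l : List Bool}
    (h : ∀ u v, u.length + v.length = l.length →
      u.count true + v.count true = l.count true → f u v = g u v) :
    unshuffleSum f l = unshuffleSum g l := by
  induction l generalizing f g with
  | nil => exact h [] [] rfl rfl
  | cons a l ih =>
    simp only [unshuffleSum]
    congr 1
    · refine ih fun u v h1 h2 => h _ _ ?_ ?_
      · simp only [List.length_cons]; omega
      · simp only [List.count_cons]; omega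
    · refine ih fun u v h1 h2 => h _ _ ?_ ?_
      · simp only [List.length_cons]; omega
      · simp only [List.count_cons]; omega

lemma unshuffleSum_zero (l : List Bool) : unshuffleSum (fun _ _ => 0) l = 0 := by
  induction l with
  | nil => rfl
  | cons a l ih => simp only [unshuffleSum, ih, add_zero]

lemma unshuffleSum_add (f g : List Bool → List Bool → ℤ) (l : List Bool) :
    unshuffleSum (fun u v => f u v + g u v) l = unshuffleSum f l + unshuffleSum g l := by
  induction l generalizing f g with
  | nil => rfl
  | cons a l ih => simp only [unshuffleSum, ih]; ring

lemma unshuffleSum_finset_sum {ι : Type*} (s : Finset ι) (f : ι → List Bool → List Bool → ℤ)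
    (l : List Bool) :
    unshuffleSum (fun u v => ∑ i ∈ s, f i u v) l = ∑ i ∈ s, unshuffleSum (f i) l := by
  classical
  induction s using Finset.induction_on with
  | empty => simp [unshuffleSum_zero]
  | insert i s hi ih => simp only [Finset.sum_insert hi, unshuffleSum_add, ih]

lemma mapDomain_cons_apply {α : Type*} [DecidableEq α] (a b : α) (x : List α →₀ ℤ) (l : List α) :
    Finsupp.mapDomain (List.cons a) x (b :: l) = if b = a then x l else 0 := by
  split_ifs with h
  · subst h
    exact Finsupp.mapDomain_apply (List.cons_injective) x l
  · exact Finsupp.mapDomain_of_notMem_range x _ (by rintro ⟨m, hm⟩; simp at hm; exact h hm.1.symm)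

lemma mapDomain_cons_nil {α : Type*} (a : α) (x : List α →₀ ℤ) :
    Finsupp.mapDomain (List.cons a) x [] = 0 :=
  Finsupp.mapDomain_of_notMem_range x _ (by rintro ⟨m, hm⟩; simp at hm)

lemma shuffle_apply (sh : XWords →ₗ[ℤ] XWords →ₗ[ℤ] XWords)
    (hsunitl : ∀ w : XWords, sh (xw []) w = w)
    (hsunitr : ∀ w : XWords, sh w (xw []) = w)
    (hsrec : ∀ (a b : Bool) (u v : List Bool),
      sh (xw (a :: u)) (xw (b :: v)) =
        Finsupp.mapDomain (List.cons a) (sh (xw u) (xw (b :: v))) +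
          Finsupp.mapDomain (List.cons b) (sh (xw (a :: u)) (xw v)))
    (u v l : List Bool) :
    sh (xw u) (xw v) l = unshuffleSum (fun u' v' => if u' = u ∧ v' = v then 1 else 0) l := by
  induction l generalizing u v with
  | nil =>
    cases u with
    | nil =>
      rw [hsunitl]
      cases v <;> simp [unshuffleSum, xw]
    | cons a u =>
      cases v with
      | nil =>
        rw [hsunitr]
        simp [unshuffleSum, xw]
      | cons b v => simp [hsrec, unshuffleSum, mapDomain_cons_nil]
  | cons c l ih =>
    have key : ∀ (a : Bool) (u v : List Bool),
        unshuffleSum (fun u' v' => if c :: u' = a :: u ∧ v' = v then 1 else 0) l =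
          if c = a then sh (xw u) (xw v) l else 0 := by
      intro a u v
      by_cases h : c = a
      · simp [h, ih]
      · simp [h, unshuffleSum_zero]
    have key' : ∀ (a : Bool) (u v : List Bool),
        unshuffleSum (fun u' v' => if u' = u ∧ c :: v' = a :: v then 1 else 0) l =
          if c = a then sh (xw u) (xw v) l else 0 := by
      intro a u v
      by_cases h : c = a
      · simp [h, ih]
      · simp [h, unshuffleSum_zero]
    cases u with
    | nil =>
      cases v with
      | nil =>
        rw [hsunitl]
        simp [unshuffleSum, xw, unshuffleSum_zero]
      | cons b v =>
        rw [unshuffleSum, key', hsunitl, hsunitl]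
        simp [unshuffleSum_zero, xw, Finsupp.single_apply]
        grind
    | cons a u =>
      cases v with
      | nil =>
        rw [unshuffleSum, key, hsunitr, hsunitr]
        simp [unshuffleSum_zero, xw, Finsupp.single_apply]
        grind
      | cons b v =>
        rw [unshuffleSum, key, key', hsrec, Finsupp.add_apply, mapDomain_cons_apply,
          mapDomain_cons_apply]

/-! ### Counting the unshuffles of an encoded word -/

/-- The left inverse of `encodeWord` on words with positive indices. -/
def decodeWord : List Bool → List ℕ
  | [] => []
  | true :: w => 1 :: decodeWord w
  | false :: w => match decodeWord w with
    | [] => []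
    | a :: s => (a + 1) :: s

lemma decodeWord_encodeWord {s : List ℕ} (hs : ∀ x ∈ s, 1 ≤ x) :
    decodeWord (encodeWord s) = s := by
  induction s with
  | nil => rfl
  | cons a s ih =>
    have hrep : ∀ m, decodeWord (List.replicate m false ++ true :: encodeWord s) =
        (m + 1) :: s := by
      intro m
      induction m with
      | zero => simp [decodeWord, ih (fun x hx => hs x (List.mem_cons_of_mem _ hx))]
      | succ m ihm => simp [List.replicate_succ, decodeWord, ihm]
    have := hs a List.mem_cons_self
    rw [encodeWord, hrep, Nat.sub_add_cancel this]

lemma one_le_of_mem_decodeWord (w : List Bool) : ∀ x ∈ decodeWord w, 1 ≤ x := by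
  induction w with
  | nil => simp [decodeWord]
  | cons b w ih =>
    cases b with
    | true => simpa [decodeWord] using ih
    | false =>
      rw [decodeWord]
      split
      · simp
      · rename_i a s h
        rw [h] at ih
        simp at ih ⊢
        exact ih.2

lemma decodeWord_ne_nil {w : List Bool} (hw : w.getLast? = some true) : decodeWord w ≠ [] := by
  induction w with
  | nil => simp at hw
  | cons b w ih =>
    cases b with
    | true => simp [decodeWord]
    | false =>
      rw [decodeWord]
      cases w with
      | nil => simp at hw
      | cons c w =>
        rw [List.getLast?_cons_cons] at hw
        have := ih hw
        split <;> simp_all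

lemma encodeWord_decodeWord {w : List Bool} (hw : w.getLast? = some true) :
    encodeWord (decodeWord w) = w := by
  induction w with
  | nil => rfl
  | cons b w ih =>
    cases w with
    | nil => cases b <;> simp_all [decodeWord, encodeWord]
    | cons c w =>
      rw [List.getLast?_cons_cons] at hw
      have ih := ih hw
      cases b with
      | true =>
        rw [decodeWord, encodeWord, ih]; rfl
      | false =>
        rw [decodeWord]
        have hne := decodeWord_ne_nil hw
        have hp := one_le_of_mem_decodeWord (c :: w)
        generalize decodeWord (c :: w) = d at *
        cases d with
        | nil => exact absurd rfl hne
        | cons a s =>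
          have ha := hp a List.mem_cons_self
          obtain ⟨a, rfl⟩ := Nat.exists_eq_add_of_le' ha
          simp only [encodeWord, Nat.add_sub_cancel] at ih ⊢
          rw [List.replicate_succ, List.cons_append, ih]

lemma length_encodeWord {s : List ℕ} (hs : ∀ x ∈ s, 1 ≤ x) :
    (encodeWord s).length = s.sum := by
  induction s with
  | nil => rfl
  | cons a s ih =>
    have := hs a List.mem_cons_self
    simp [encodeWord, ih (fun x hx => hs x (List.mem_cons_of_mem _ hx))]
    omega

lemma count_encodeWord (s : List ℕ) : (encodeWord s).count true = s.length := by
  induction s with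
  | nil => rfl
  | cons a s ih => simp [encodeWord, ih, List.count_replicate]

lemma getLast?_encodeWord {s : List ℕ} (hs : s ≠ []) :
    (encodeWord s).getLast? = some true := by
  induction s with
  | nil => exact absurd rfl hs
  | cons a s ih =>
    cases s with
    | nil => simp [encodeWord]
    | cons b s =>
      rw [encodeWord, List.getLast?_append, List.getLast?_cons, ih (by simp)]
      simp

lemma head?_encodeWord {s : List ℕ} : (encodeWord s).head? = some false ↔ 2 ≤ s.headI := by
  cases s with
  | nil => simp [encodeWord]
  | cons a s =>
    rcases Nat.lt_or_ge a 2 with h | h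
    · have : a - 1 = 0 := by omega
      simp [encodeWord, this, h]
    · obtain ⟨a, rfl⟩ := Nat.exists_eq_add_of_le' h
      simp [encodeWord, List.replicate_succ]

/-- Indicator of the words `x₀ ⋯ x₀ x₁`. -/
def depthOneInd : List Bool → ℤ
  | [] => 0
  | false :: u => depthOneInd u
  | true :: u => if u = [] then 1 else 0

/-- Indicator of the words ending in `x₁`. -/
def endInd (w : List Bool) : ℤ := if w.getLast? = some true then 1 else 0

/-- Indicator of the admissible words. -/
def admInd (w : List Bool) : ℤ :=
  if w.head? = some false ∧ w.getLast? = some true then 1 else 0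

open Classical in
lemma depthOneInd_eq (u : List Bool) :
    depthOneInd u = if ∃ i, List.replicate i false ++ [true] = u then 1 else 0 := by
  induction u with
  | nil => simp [depthOneInd]
  | cons b u ih =>
    cases b with
    | true =>
      rw [depthOneInd]
      refine if_congr ⟨?_, ?_⟩ rfl rfl
      · rintro rfl; exact ⟨0, rfl⟩
      · rintro ⟨i, hi⟩
        cases i <;> simp_all [List.replicate_succ]
    | false =>
      rw [depthOneInd, ih]
      refine if_congr ⟨?_, ?_⟩ rfl rfl
      · rintro ⟨i, rfl⟩; exact ⟨i + 1, rfl⟩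
      · rintro ⟨i, hi⟩
        cases i with
        | zero => simp at hi
        | succ i => exact ⟨i, by simpa [List.replicate_succ] using hi⟩

lemma unshuffleSum_left_nil (g : List Bool → ℤ) (l : List Bool) :
    unshuffleSum (fun u v => (if u = [] then 1 else 0) * g v) l = g l := by
  induction l generalizing g with
  | nil => simp [unshuffleSum]
  | cons a l ih =>
    have := ih (fun v => g (a :: v))
    simp [unshuffleSum, unshuffleSum_zero] at this ⊢
    exact this

lemma unshuffleSum_depthOne_false (g : List Bool → ℤ) (l : List Bool) :
    unshuffleSum (fun u v => depthOneInd u * g v) (false :: l) =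
      unshuffleSum (fun u v => depthOneInd u * g v) l +
        unshuffleSum (fun u v => depthOneInd u * g (false :: v)) l := rfl

lemma unshuffleSum_depthOne_true (g : List Bool → ℤ) (l : List Bool) :
    unshuffleSum (fun u v => depthOneInd u * g v) (true :: l) =
      g l + unshuffleSum (fun u v => depthOneInd u * g (true :: v)) l := by
  rw [← unshuffleSum_left_nil g l]
  rfl

lemma endInd_false (w : List Bool) : endInd (false :: w) = endInd w := by
  cases w <;> simp [endInd, List.getLast?_cons_cons]

lemma endInd_true (w : List Bool) : endInd (true :: w) = endInd w + if w = [] then 1 else 0 := by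
  cases w <;> simp [endInd, List.getLast?_cons_cons]

lemma admInd_false (w : List Bool) : admInd (false :: w) = endInd w := by
  rw [← endInd_false]
  simp [admInd, endInd]

lemma admInd_true (w : List Bool) : admInd (true :: w) = 0 := by
  simp [admInd]

lemma unshuffleSum_depthOne_nil (l : List Bool) :
    unshuffleSum (fun u v => depthOneInd u * if v = [] then 1 else 0) l = depthOneInd l := by
  induction l with
  | nil => simp [unshuffleSum]
  | cons b l ih =>
    cases b with
    | false => rw [unshuffleSum_depthOne_false, ih]; simp [unshuffleSum_zero, depthOneInd]
    | true => rw [unshuffleSum_depthOne_true]; simp [unshuffleSum_zero, depthOneInd]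

lemma unshuffleSum_end_replicate (m : ℕ) (l : List Bool) :
    unshuffleSum (fun u v => depthOneInd u * endInd v) (List.replicate m false ++ true :: l) =
      2 ^ m * (endInd l + unshuffleSum (fun u v => depthOneInd u * endInd v) l +
        depthOneInd l) := by
  induction m with
  | zero =>
    simp only [List.replicate_zero, List.nil_append]
    rw [unshuffleSum_depthOne_true]
    simp only [endInd_true, mul_add, unshuffleSum_add, unshuffleSum_depthOne_nil]
    ring
  | succ m ih =>
    rw [List.replicate_succ, List.cons_append, unshuffleSum_depthOne_false]
    simp only [endInd_false, ih]
    ring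

lemma unshuffleSum_adm_replicate (m : ℕ) (l : List Bool) :
    unshuffleSum (fun u v => depthOneInd u * admInd v) (List.replicate m false ++ true :: l) =
      (2 ^ m - 1) * (endInd l + unshuffleSum (fun u v => depthOneInd u * endInd v) l +
        depthOneInd l) + admInd l := by
  induction m with
  | zero =>
    simp only [List.replicate_zero, List.nil_append]
    rw [unshuffleSum_depthOne_true]
    simp only [admInd_true, mul_zero, unshuffleSum_zero]
    ring
  | succ m ih =>
    rw [List.replicate_succ, List.cons_append, unshuffleSum_depthOne_false]
    simp only [admInd_false, ih, unshuffleSum_end_replicate]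
    ring

lemma Ccoef_nil : Ccoef [] = 1 := rfl

lemma Ccoef_cons {a : ℕ} {t : List ℕ} (ha : 1 ≤ a) (ht : ∀ x ∈ t, 1 ≤ x) :
    Ccoef (a :: t) = 2 ^ (a - 1) * (1 + Ccoef t) := by
  have hlen : ∀ l : List ℕ, (∀ x ∈ l, 1 ≤ x) → l.length ≤ l.sum := fun l h =>
    List.length_le_sum_of_one_le l h
  simp only [Ccoef, List.length_cons, Finset.sum_range_succ', List.take_succ_cons, List.sum_cons,
    List.take_zero, List.sum_nil]
  have h1 : ∑ j ∈ Finset.range t.length, (2 : ℤ) ^ (a + (t.take (j + 1)).sum - (j + 1 + 1)) =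
      2 ^ (a - 1) * ∑ j ∈ Finset.range t.length, (2 : ℤ) ^ ((t.take (j + 1)).sum - (j + 1)) := by
    rw [Finset.mul_sum]
    refine Finset.sum_congr rfl fun j hj => ?_
    have := hlen (t.take (j + 1)) fun x hx => ht x (List.mem_of_mem_take hx)
    rw [List.length_take] at this
    rw [Finset.mem_range] at hj
    rw [← pow_add]
    congr 1
    omega
  have h2 : (2 : ℤ) ^ (a + t.sum - (t.length + 1)) = 2 ^ (a - 1) * 2 ^ (t.sum - t.length) := by
    have := hlen t ht
    rw [← pow_add]
    congr 1
    omega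
  rw [h1, h2]
  simp
  ring

lemma depthOneInd_encodeWord (t : List ℕ) :
    depthOneInd (encodeWord t) = if t.length = 1 then 1 else 0 := by
  cases t with
  | nil => rfl
  | cons a t =>
    have : ∀ m, depthOneInd (List.replicate m false ++ true :: encodeWord t) =
        if t.length + 1 = 1 then 1 else 0 := by
      intro m
      induction m with
      | zero => cases t <;> simp [depthOneInd, encodeWord]
      | succ m ih => rw [← ih]; rfl
    exact this _

lemma endInd_encodeWord (t : List ℕ) : endInd (encodeWord t) = if t = [] then 0 else 1 := by
  split_ifs with h
  · subst h; rfl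
  · rw [endInd, if_pos (getLast?_encodeWord h)]

lemma admInd_encodeWord (t : List ℕ) : admInd (encodeWord t) = if 2 ≤ t.headI then 1 else 0 := by
  rw [admInd]
  refine if_congr ?_ rfl rfl
  rw [head?_encodeWord, and_iff_left_iff_imp]
  intro h
  refine getLast?_encodeWord ?_
  rintro rfl
  simp at h

lemma unshuffleSum_end_encodeWord {t : List ℕ} (ht : ∀ x ∈ t, 1 ≤ x) (hne : t ≠ []) :
    unshuffleSum (fun u v => depthOneInd u * endInd v) (encodeWord t) +
      depthOneInd (encodeWord t) = Ccoef t.dropLast := by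
  induction t with
  | nil => exact absurd rfl hne
  | cons a t ih =>
    have ha := ht a List.mem_cons_self
    have ht' : ∀ x ∈ t, 1 ≤ x := fun x hx => ht x (List.mem_cons_of_mem _ hx)
    rw [depthOneInd_encodeWord, encodeWord, unshuffleSum_end_replicate, add_assoc,
      endInd_encodeWord]
    rcases eq_or_ne t [] with rfl | hn
    · simp [encodeWord, unshuffleSum, depthOneInd, Ccoef_nil]
    · rw [ih ht' hn, List.dropLast_cons_of_ne_nil hn,
        Ccoef_cons ha fun x hx => ht' x (List.mem_of_mem_dropLast hx)]
      simp [hn]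

lemma unshuffleSum_adm_encodeWord {a b : ℕ} {t : List ℕ} (ht : ∀ x ∈ a :: b :: t, 1 ≤ x) :
    unshuffleSum (fun u v => depthOneInd u * admInd v) (encodeWord (a :: b :: t)) =
      Ccoef (a :: b :: t).dropLast - Ccoef (b :: t).dropLast - 1 + if 2 ≤ b then 1 else 0 := by
  have ha := ht a List.mem_cons_self
  have ht' : ∀ x ∈ b :: t, 1 ≤ x := fun x hx => ht x (List.mem_cons_of_mem _ hx)
  rw [encodeWord, unshuffleSum_adm_replicate, add_assoc,
    unshuffleSum_end_encodeWord ht' (by simp), endInd_encodeWord, admInd_encodeWord,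
    List.dropLast_cons_of_ne_nil (List.cons_ne_nil b t),
    Ccoef_cons ha fun x hx => ht' x (List.mem_of_mem_dropLast hx),
    if_neg (List.cons_ne_nil b t), List.headI_cons]
  ring

lemma encodeWord_injOn : Set.InjOn encodeWord {s | ∀ x ∈ s, 1 ≤ x} := by
  intro s hs t ht h
  rw [← decodeWord_encodeWord hs, h, decodeWord_encodeWord ht]

lemma sum_admissiblePairs_indicator {k n : ℕ} {u v : List Bool}
    (hn : u.length + v.length = n) (hk : u.count true + v.count true = k + 1) :
    ∑ p ∈ admissiblePairs k n, (if u = encodeWord [p.1] ∧ v = encodeWord p.2 then (1 : ℤ) else 0) =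
      depthOneInd u * admInd v := by
  classical
  by_cases h : (∃ i, List.replicate i false ++ [true] = u) ∧
      v.head? = some false ∧ v.getLast? = some true
  · obtain ⟨⟨i, rfl⟩, hv, hl⟩ := h
    have henc := encodeWord_decodeWord hl
    have hpos := one_le_of_mem_decodeWord v
    have hlen := length_encodeWord hpos
    have hcount := count_encodeWord (decodeWord v)
    rw [henc] at hlen hcount
    have hhead : 2 ≤ (decodeWord v).headI := by rwa [← head?_encodeWord, henc]
    rw [depthOneInd_eq, if_pos ⟨i, rfl⟩, admInd, if_pos ⟨hv, hl⟩, mul_one,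
      Finset.sum_eq_single (i + 1, decodeWord v), if_pos ⟨by simp [encodeWord], henc.symm⟩]
    · rintro ⟨r, w⟩ hp hne
      obtain ⟨hr, hw, -⟩ := mem_admissiblePairs.1 hp
      refine if_neg ?_
      rintro ⟨h1, rfl⟩
      refine hne ?_
      have h1 := congrArg List.length h1
      simp [encodeWord] at h1
      rw [decodeWord_encodeWord hw, h1, Nat.sub_add_cancel hr]
    · intro hnot
      refine absurd (mem_admissiblePairs.2 ⟨by omega, hpos, hhead, ?_, ?_⟩) hnot
      · simp [List.count_replicate] at hk; omega
      · simp at hn; omega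
  · have h0 : depthOneInd u * admInd v = 0 := by
      rw [depthOneInd_eq, admInd]
      rcases not_and_or.1 h with h | h <;> simp [h]
    rw [h0]
    refine Finset.sum_eq_zero fun p hp => if_neg ?_
    obtain ⟨r, w⟩ := p
    obtain ⟨-, -, h2, -⟩ := mem_admissiblePairs.1 hp
    rintro ⟨rfl, rfl⟩
    refine h ⟨⟨r - 1, rfl⟩, head?_encodeWord.2 h2, getLast?_encodeWord ?_⟩
    rintro rfl
    simp at h2

lemma sum_shuffle_apply (sh : XWords →ₗ[ℤ] XWords →ₗ[ℤ] XWords)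
    (hsunitl : ∀ w : XWords, sh (xw []) w = w)
    (hsunitr : ∀ w : XWords, sh w (xw []) = w)
    (hsrec : ∀ (a b : Bool) (u v : List Bool),
      sh (xw (a :: u)) (xw (b :: v)) =
        Finsupp.mapDomain (List.cons a) (sh (xw u) (xw (b :: v))) +
          Finsupp.mapDomain (List.cons b) (sh (xw (a :: u)) (xw v)))
    (k n : ℕ) {t : List ℕ} (ht : ∀ x ∈ t, 1 ≤ x) :
    ∑ p ∈ admissiblePairs k n, sh (xw (encodeWord [p.1])) (xw (encodeWord p.2)) (encodeWord t) =
      if t.length = k + 1 ∧ t.sum = n then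
        unshuffleSum (fun u v => depthOneInd u * admInd v) (encodeWord t) else 0 := by
  simp only [shuffle_apply sh hsunitl hsunitr hsrec, ← unshuffleSum_finset_sum]
  split_ifs with h
  · refine unshuffleSum_congr fun u v hl hc => sum_admissiblePairs_indicator ?_ ?_
    · rw [hl, length_encodeWord ht, h.2]
    · rw [hc, count_encodeWord, h.1]
  · refine Eq.trans (unshuffleSum_congr fun u v hl hc => ?_) (unshuffleSum_zero (encodeWord t))
    refine Finset.sum_eq_zero fun p hp => if_neg ?_
    rintro ⟨rfl, rfl⟩
    obtain ⟨r, w⟩ := p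
    obtain ⟨hr, hw, -, hk, hs⟩ := mem_admissiblePairs.1 hp
    rw [length_encodeWord ht, length_encodeWord hw, length_encodeWord (by simpa using hr)] at hl
    simp only [count_encodeWord] at hc
    simp at hl hc
    exact h ⟨by omega, by omega⟩

/-! ### Coefficients of the quasi-shuffle product with a word of depth one -/

/-- The sum of `f r w` over all the ways in which a given word occurs in `z_r * w`. -/
def unstuffleSum (f : ℕ → List ℕ → ℤ) : List ℕ → ℤ
  | [] => 0
  | a :: t => f a t + ∑ i ∈ Finset.Ico 1 a, f i ((a - i) :: t) +
      unstuffleSum (fun r w => f r (a :: w)) t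

lemma unstuffleSum_zero (t : List ℕ) : unstuffleSum (fun _ _ => 0) t = 0 := by
  induction t with
  | nil => rfl
  | cons a t ih => simp [unstuffleSum, ih]

lemma unstuffleSum_add (f g : ℕ → List ℕ → ℤ) (t : List ℕ) :
    unstuffleSum (fun u v => f u v + g u v) t = unstuffleSum f t + unstuffleSum g t := by
  induction t generalizing f g with
  | nil => rfl
  | cons a l ih => simp only [unstuffleSum, ih, Finset.sum_add_distrib]; ring

lemma unstuffleSum_finset_sum {ι : Type*} (s : Finset ι) (f : ι → ℕ → List ℕ → ℤ) (t : List ℕ) :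
    unstuffleSum (fun u v => ∑ i ∈ s, f i u v) t = ∑ i ∈ s, unstuffleSum (f i) t := by
  classical
  induction s using Finset.induction_on with
  | empty => simp [unstuffleSum_zero]
  | insert i s hi ih => simp only [Finset.sum_insert hi, unstuffleSum_add, ih]

lemma zcons_apply_cons (r a : ℕ) (x : QWords) (t : List ℕ) :
    zcons r x (a :: t) = if a = r then x t else 0 :=
  mapDomain_cons_apply r a x t

lemma zcons_apply_nil (r : ℕ) (x : QWords) : zcons r x [] = 0 :=
  mapDomain_cons_nil r x

lemma stuffle_apply (mul : QWords →ₗ[ℤ] QWords →ₗ[ℤ] QWords)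
    (hunitl : ∀ w : QWords, mul (zw []) w = w)
    (hunitr : ∀ w : QWords, mul w (zw []) = w)
    (hrec : ∀ (r s : ℕ) (u v : List ℕ), 1 ≤ r → 1 ≤ s →
      (∀ x ∈ u, 1 ≤ x) → (∀ x ∈ v, 1 ≤ x) →
      mul (zw (r :: u)) (zw (s :: v)) =
        zcons r (mul (zw u) (zw (s :: v))) + zcons s (mul (zw (r :: u)) (zw v)) +
          zcons (r + s) (mul (zw u) (zw v)))
    {r : ℕ} (hr : 1 ≤ r) {w : List ℕ} (hw : ∀ x ∈ w, 1 ≤ x) (t : List ℕ) :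
    mul (zw [r]) (zw w) t = unstuffleSum (fun r' w' => if r' = r ∧ w' = w then 1 else 0) t := by
  induction w generalizing t with
  | nil =>
    rw [hunitr]
    cases t with
    | nil => simp [unstuffleSum, zw]
    | cons a t =>
      simp [unstuffleSum, unstuffleSum_zero, zw, Finsupp.single_apply]
      grind
  | cons s w ih =>
    have hs := hw s List.mem_cons_self
    have hw' : ∀ x ∈ w, 1 ≤ x := fun x hx => hw x (List.mem_cons_of_mem _ hx)
    rw [hrec r s [] w hr hs (by simp) hw', hunitl, hunitl]
    cases t with
    | nil => simp [unstuffleSum, zcons_apply_nil]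
    | cons a t =>
      simp only [Finsupp.add_apply, zcons_apply_cons, ih hw', unstuffleSum]
      have h1 : (if a = r then zw (s :: w) t else 0) = if a = r ∧ t = s :: w then 1 else 0 := by
        simp only [zw, Finsupp.single_apply, ite_and, eq_comm]
      have h2 : (if a = s then
          unstuffleSum (fun r' w' => if r' = r ∧ w' = w then 1 else 0) t else 0) =
          unstuffleSum (fun r' w' => if r' = r ∧ a :: w' = s :: w then 1 else 0) t := by
        by_cases h : a = s
        · simp [h]
        · simp [h, unstuffleSum_zero]
      have h3 : (if a = r + s then zw w t else 0) =
          ∑ i ∈ Finset.Ico 1 a, if i = r ∧ (a - i) :: t = s :: w then 1 else 0 := by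
        simp only [zw, Finsupp.single_apply, ite_and, Finset.sum_ite_eq', Finset.mem_Ico]
        grind
      rw [h1, h2, h3]
      ring

open Classical in
lemma unstuffleSum_pos (Q : ℕ → ℕ → ℤ) (t : List ℕ) :
    unstuffleSum (fun r w => if 1 ≤ r ∧ (∀ x ∈ w, 1 ≤ x) then Q (w.length + 1) (r + w.sum)
      else 0) t =
    if ∀ x ∈ t, 1 ≤ x then
      t.length * Q t.length t.sum + (t.sum - t.length) * Q (t.length + 1) t.sum
    else 0 := by
  induction t generalizing Q with
  | nil => simp [unstuffleSum]
  | cons a t ih =>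
    have hmerge : ∀ i ∈ Finset.Ico 1 a, (if 1 ≤ i ∧ (∀ x ∈ (a - i) :: t, 1 ≤ x) then
        Q (((a - i) :: t).length + 1) (i + ((a - i) :: t).sum) else 0) =
        if ∀ x ∈ t, 1 ≤ x then Q (t.length + 2) (a + t.sum) else 0 := by
      intro i hi
      rw [Finset.mem_Ico] at hi
      simp only [List.forall_mem_cons, hi.1, Nat.sub_pos_of_lt hi.2, Nat.succ_le_iff, true_and,
        List.length_cons, List.sum_cons, ← Nat.add_assoc, Nat.add_sub_cancel' hi.2.le]
    have hrest : unstuffleSum (fun r w => if 1 ≤ r ∧ (∀ x ∈ a :: w, 1 ≤ x) then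
        Q ((a :: w).length + 1) (r + (a :: w).sum) else 0) t =
        if 1 ≤ a ∧ ∀ x ∈ t, 1 ≤ x then
          t.length * Q (t.length + 1) (a + t.sum) +
            (t.sum - t.length) * Q (t.length + 2) (a + t.sum)
        else 0 := by
      by_cases ha : 1 ≤ a
      · simpa only [List.forall_mem_cons, ha, true_and, List.length_cons, List.sum_cons,
          Nat.add_left_comm a] using ih (fun l s => Q (l + 1) (a + s))
      · simp [ha, unstuffleSum_zero]
    rw [unstuffleSum, Finset.sum_congr rfl hmerge, hrest, Finset.sum_const, Nat.card_Ico]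
    simp only [List.forall_mem_cons]
    by_cases ht : ∀ x ∈ t, 1 ≤ x
    · rcases Nat.eq_zero_or_pos a with rfl | ha
      · simp
      · simp only [if_pos ht, if_pos (And.intro (Nat.succ_le_of_lt ha) ht), List.length_cons,
          List.sum_cons, nsmul_eq_mul]
        push_cast [Nat.succ_le_of_lt ha]
        ring
    · simp [ht]

open Classical in
lemma unstuffleSum_adm (Q : ℕ → ℕ → ℤ) (a : ℕ) (t : List ℕ) :
    unstuffleSum (fun r w => if 1 ≤ r ∧ (∀ x ∈ w, 1 ≤ x) ∧ 2 ≤ w.headI then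
      Q (w.length + 1) (r + w.sum) else 0) (a :: t) =
    if ∀ x ∈ a :: t, 1 ≤ x then
      (if 2 ≤ t.headI then Q (a :: t).length (a :: t).sum else 0) +
      (if 2 ≤ a then t.length * Q (a :: t).length (a :: t).sum +
        ((a :: t).sum - (a :: t).length - 1) * Q ((a :: t).length + 1) (a :: t).sum else 0)
    else 0 := by
  have hmerge : ∀ i ∈ Finset.Ico 1 a, (if 1 ≤ i ∧ (∀ x ∈ (a - i) :: t, 1 ≤ x) ∧
      2 ≤ ((a - i) :: t).headI then
        Q (((a - i) :: t).length + 1) (i + ((a - i) :: t).sum) else 0) =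
      if i ∈ Finset.Ico 1 (a - 1) then
        (if ∀ x ∈ t, 1 ≤ x then Q (t.length + 2) (a + t.sum) else 0) else 0 := by
    intro i hi
    rw [Finset.mem_Ico] at hi
    have h2 : 2 ≤ a - i ↔ i ∈ Finset.Ico 1 (a - 1) := by
      rw [Finset.mem_Ico]; omega
    simp only [List.forall_mem_cons, hi.1, Nat.sub_pos_of_lt hi.2, Nat.succ_le_iff, true_and,
      List.length_cons, List.sum_cons, ← Nat.add_assoc, Nat.add_sub_cancel' hi.2.le,
      List.headI_cons]
    rw [Nat.succ_le_iff] at h2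
    simp only [h2, ← ite_and, and_comm]
  have hrest : unstuffleSum (fun r w => if 1 ≤ r ∧ (∀ x ∈ a :: w, 1 ≤ x) ∧ 2 ≤ (a :: w).headI then
      Q ((a :: w).length + 1) (r + (a :: w).sum) else 0) t =
      if 2 ≤ a ∧ ∀ x ∈ t, 1 ≤ x then
        t.length * Q (t.length + 1) (a + t.sum) +
          (t.sum - t.length) * Q (t.length + 2) (a + t.sum)
      else 0 := by
    by_cases ha : 2 ≤ a
    · simpa only [List.forall_mem_cons, ha, (by omega : 1 ≤ a), true_and, and_true,
        List.headI_cons, List.length_cons, List.sum_cons,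
        Nat.add_left_comm a] using unstuffleSum_pos (fun l s => Q (l + 1) (a + s)) t
    · simp [ha, unstuffleSum_zero]
  have hsub : (Finset.Ico 1 a).filter (· ∈ Finset.Ico 1 (a - 1)) = Finset.Ico 1 (a - 1) := by
    ext i; simp only [Finset.mem_filter, Finset.mem_Ico]; omega
  rw [unstuffleSum, Finset.sum_congr rfl hmerge, hrest, ← Finset.sum_filter, hsub,
    Finset.sum_const, Nat.card_Ico]
  simp only [List.forall_mem_cons]
  by_cases ht : ∀ x ∈ t, 1 ≤ x
  · simp only [eq_true ht, true_and, and_true, if_true]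
    rcases Nat.lt_or_ge a 2 with ha | ha
    · interval_cases a <;> simp
    · obtain ⟨b, rfl⟩ := Nat.exists_eq_add_of_le' ha
      simp only [ha, (by omega : 1 ≤ b + 2), (by omega : b + 2 - 1 - 1 = b), true_and, if_true,
        nsmul_eq_mul, List.length_cons, List.sum_cons]
      push_cast
      ring
  · simp [ht]

lemma sum_stuffle_apply (mul : QWords →ₗ[ℤ] QWords →ₗ[ℤ] QWords)
    (hunitl : ∀ w : QWords, mul (zw []) w = w)
    (hunitr : ∀ w : QWords, mul w (zw []) = w)
    (hrec : ∀ (r s : ℕ) (u v : List ℕ), 1 ≤ r → 1 ≤ s →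
      (∀ x ∈ u, 1 ≤ x) → (∀ x ∈ v, 1 ≤ x) →
      mul (zw (r :: u)) (zw (s :: v)) =
        zcons r (mul (zw u) (zw (s :: v))) + zcons s (mul (zw (r :: u)) (zw v)) +
          zcons (r + s) (mul (zw u) (zw v)))
    (k n : ℕ) (t : List ℕ) :
    ∑ p ∈ admissiblePairs k n, mul (zw [p.1]) (zw p.2) t =
      unstuffleSum (fun r w => if 1 ≤ r ∧ (∀ x ∈ w, 1 ≤ x) ∧ 2 ≤ w.headI then
        (if w.length + 1 = k + 1 ∧ r + w.sum = n then 1 else 0) else 0) t := by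
  classical
  have h : ∀ p ∈ admissiblePairs k n, mul (zw [p.1]) (zw p.2) t =
      unstuffleSum (fun r w => if r = p.1 ∧ w = p.2 then 1 else 0) t := by
    rintro ⟨r, w⟩ hp
    obtain ⟨hr, hw, -⟩ := mem_admissiblePairs.1 hp
    exact stuffle_apply mul hunitl hunitr hrec hr hw t
  rw [Finset.sum_congr rfl h, ← unstuffleSum_finset_sum]
  congr 1
  funext r w
  have hpair : ∀ p : ℕ × List ℕ, (r = p.1 ∧ w = p.2) ↔ (r, w) = p := fun p => by
    rw [Prod.ext_iff]
  simp only [hpair, Finset.sum_ite_eq, mem_admissiblePairs, ← ite_and, and_assoc,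
    Nat.add_right_cancel_iff]

lemma sum_doubleShuffle (mul : QWords →ₗ[ℤ] QWords →ₗ[ℤ] QWords)
    (hunitl : ∀ w : QWords, mul (zw []) w = w)
    (hunitr : ∀ w : QWords, mul w (zw []) = w)
    (hrec : ∀ (r s : ℕ) (u v : List ℕ), 1 ≤ r → 1 ≤ s →
      (∀ x ∈ u, 1 ≤ x) → (∀ x ∈ v, 1 ≤ x) →
      mul (zw (r :: u)) (zw (s :: v)) =
        zcons r (mul (zw u) (zw (s :: v))) + zcons s (mul (zw (r :: u)) (zw v)) +
          zcons (r + s) (mul (zw u) (zw v)))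
    (sh : XWords →ₗ[ℤ] XWords →ₗ[ℤ] XWords)
    (hsunitl : ∀ w : XWords, sh (xw []) w = w)
    (hsunitr : ∀ w : XWords, sh w (xw []) = w)
    (hsrec : ∀ (a b : Bool) (u v : List Bool),
      sh (xw (a :: u)) (xw (b :: v)) =
        Finsupp.mapDomain (List.cons a) (sh (xw u) (xw (b :: v))) +
          Finsupp.mapDomain (List.cons b) (sh (xw (a :: u)) (xw v)))
    (msh : QWords →ₗ[ℤ] QWords →ₗ[ℤ] QWords)
    (hsupp : ∀ u v : List ℕ, (∀ x ∈ u, 1 ≤ x) → (∀ x ∈ v, 1 ≤ x) →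
      ∀ l ∈ (msh (zw u) (zw v)).support, ∀ x ∈ l, 1 ≤ x)
    (hcompat : ∀ u v : List ℕ, (∀ x ∈ u, 1 ≤ x) → (∀ x ∈ v, 1 ≤ x) →
      Finsupp.mapDomain encodeWord (msh (zw u) (zw v)) =
        sh (xw (encodeWord u)) (xw (encodeWord v)))
    {k : ℕ} (hk : 1 ≤ k) (n : ℕ) :
    ∑ p ∈ admissiblePairs k n, (msh (zw [p.1]) (zw p.2) - mul (zw [p.1]) (zw p.2)) =
      ∑ t ∈ admissibleWords (k + 1) n,
          (Ccoef (t.take k) - Ccoef (t.tail.take (k - 1)) - (k + 1)) • zw t -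
        ((n : ℤ) - (k + 1)) • ∑ t ∈ admissibleWords k n, zw t := by
  classical
  have hmsh : ∀ t : List ℕ, ∑ p ∈ admissiblePairs k n, msh (zw [p.1]) (zw p.2) t =
      if (∀ x ∈ t, 1 ≤ x) ∧ t.length = k + 1 ∧ t.sum = n then
        unshuffleSum (fun u v => depthOneInd u * admInd v) (encodeWord t) else 0 := by
    intro t
    by_cases ht : ∀ x ∈ t, 1 ≤ x
    · simp only [eq_true ht, true_and]
      rw [← sum_shuffle_apply sh hsunitl hsunitr hsrec k n ht]
      refine Finset.sum_congr rfl ?_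
      rintro ⟨r, w⟩ hp
      obtain ⟨hr, hw, -⟩ := mem_admissiblePairs.1 hp
      have hr' : ∀ x ∈ [r], 1 ≤ x := by simpa using hr
      rw [← hcompat _ _ hr' hw]
      exact (Finsupp.mapDomain_apply' {s | ∀ x ∈ s, 1 ≤ x} _
        (fun l hl => hsupp _ _ hr' hw l hl) encodeWord_injOn ht).symm
    · rw [if_neg fun h => ht h.1]
      refine Finset.sum_eq_zero ?_
      rintro ⟨r, w⟩ hp
      obtain ⟨hr, hw, -⟩ := mem_admissiblePairs.1 hp
      by_contra hne
      exact ht (hsupp _ _ (by simpa using hr) hw t (Finsupp.mem_support_iff.2 hne))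
  have hzw : ∀ (s : Finset (List ℕ)) (c : List ℕ → ℤ) (t : List ℕ),
      (∑ l ∈ s, c l • zw l) t = if t ∈ s then c t else 0 := by
    intro s c t
    simp [zw, Finsupp.finsetSum_apply, Finsupp.single_apply]
  ext t
  rw [Finset.smul_sum, Finsupp.sub_apply, hzw, hzw, Finset.sum_sub_distrib, Finsupp.sub_apply,
    Finsupp.finsetSum_apply, Finsupp.finsetSum_apply, hmsh,
    sum_stuffle_apply mul hunitl hunitr hrec]
  simp only [mem_admissibleWords]
  cases t with
  | nil => simp [unstuffleSum]
  | cons a t =>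
    rw [unstuffleSum_adm (fun l s => if l = k + 1 ∧ s = n then 1 else 0)]
    by_cases hp : ∀ x ∈ a :: t, 1 ≤ x
    swap
    · simp only [hp, false_and, if_false, sub_zero]
    by_cases hs : (a :: t).sum = n
    swap
    · simp only [hs, false_and, and_false, if_false, sub_zero, mul_zero, add_zero, ite_self]
    by_cases hl : (a :: t).length = k + 1
    · cases t with
      | nil => simp at hl; omega
      | cons b t =>
        have h1 : (a :: b :: t).take k = (a :: b :: t).dropLast := by
          rw [List.dropLast_eq_take, hl, Nat.add_sub_cancel]
        have h2 : (a :: b :: t).tail.take (k - 1) = (b :: t).dropLast := by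
          rw [List.dropLast_eq_take, List.tail_cons]
          congr 1
          simp at hl ⊢; omega
        have ha := hp a List.mem_cons_self
        rw [h1, h2, unshuffleSum_adm_encodeWord hp]
        simp only [eq_true hp, hs, hl, true_and, and_self, and_true, if_true, List.headI_cons]
        simp only [Nat.succ_ne_self, if_false, mul_zero, add_zero]
        have hlen : ((b :: t).length : ℤ) = k := by
          rw [List.length_cons] at hl
          exact_mod_cast Nat.succ_injective hl
        by_cases h : 2 ≤ a
        · simp only [h, if_true, hlen, false_and, if_false]
          ring
        · have hC : Ccoef (a :: b :: t).dropLast = 1 + Ccoef (b :: t).dropLast := by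
            rw [List.dropLast_cons_of_ne_nil (List.cons_ne_nil b t), Ccoef_cons ha fun x hx =>
              hp x (List.mem_cons_of_mem _ (List.mem_of_mem_dropLast hx)),
              (by omega : a - 1 = 0), pow_zero, one_mul]
          simp only [h, if_false, false_and, hC]
          ring
    · simp only [eq_true hp, hs, hl, true_and, false_and, and_true, if_true, if_false]
      by_cases hl' : (a :: t).length = k
      · by_cases h : 2 ≤ a
        · simp only [h, hl', List.headI_cons, if_true, and_self, ite_self]
          ring
        · simp only [h, List.headI_cons, if_false, and_false, ite_self, add_zero]
      · simp only [hl', Nat.add_right_cancel_iff, if_false, false_and, mul_zero, ite_self,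
          add_zero]

/-- (Weighted sum formula, assuming the sum formula and the
extended double shuffle vanishing as hypotheses.)  If a ℤ-linear map `ζ` kills the
extended double shuffle relations among admissible words and satisfies the sum
formula, then for all `k ≥ 2` and `n ≥ k+1`,
`∑_{s₁≥2, ∑sᵢ=n} [C(s₁,…,s_{k-1}) − C(s₂,…,s_{k-1})] ζ(z_{s₁,…,s_k}) = n ζ(z_n)`. -/
theorem weighted_sum_formula_abstract
    (mul : QWords →ₗ[ℤ] QWords →ₗ[ℤ] QWords)
    (hunitl : ∀ w : QWords, mul (zw []) w = w)
    (hunitr : ∀ w : QWords, mul w (zw []) = w)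
    (hrec : ∀ (r s : ℕ) (u v : List ℕ), 1 ≤ r → 1 ≤ s →
      (∀ x ∈ u, 1 ≤ x) → (∀ x ∈ v, 1 ≤ x) →
      mul (zw (r :: u)) (zw (s :: v)) =
        zcons r (mul (zw u) (zw (s :: v))) + zcons s (mul (zw (r :: u)) (zw v)) +
          zcons (r + s) (mul (zw u) (zw v)))
    (sh : XWords →ₗ[ℤ] XWords →ₗ[ℤ] XWords)
    (hsunitl : ∀ w : XWords, sh (xw []) w = w)
    (hsunitr : ∀ w : XWords, sh w (xw []) = w)
    (hsrec : ∀ (a b : Bool) (u v : List Bool),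
      sh (xw (a :: u)) (xw (b :: v)) =
        Finsupp.mapDomain (List.cons a) (sh (xw u) (xw (b :: v))) +
          Finsupp.mapDomain (List.cons b) (sh (xw (a :: u)) (xw v)))
    (msh : QWords →ₗ[ℤ] QWords →ₗ[ℤ] QWords)
    (hsupp : ∀ u v : List ℕ, (∀ x ∈ u, 1 ≤ x) → (∀ x ∈ v, 1 ≤ x) →
      ∀ l ∈ (msh (zw u) (zw v)).support, ∀ x ∈ l, 1 ≤ x)
    (hcompat : ∀ u v : List ℕ, (∀ x ∈ u, 1 ≤ x) → (∀ x ∈ v, 1 ≤ x) →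
      Finsupp.mapDomain encodeWord (msh (zw u) (zw v)) =
        sh (xw (encodeWord u)) (xw (encodeWord v)))
    (R : Type*) [CommRing R] (ζ : QWords →ₗ[ℤ] R)
    -- (i) ζ kills the extended double shuffle relations among admissible words
    (hds : ∀ u v : List ℕ, (∀ x ∈ u, 1 ≤ x) → (∀ x ∈ v, 1 ≤ x) →
      2 ≤ u.headI → 2 ≤ v.headI →
      ζ (msh (zw u) (zw v) - mul (zw u) (zw v)) = 0)
    (hds1 : ∀ v : List ℕ, (∀ x ∈ v, 1 ≤ x) → 2 ≤ v.headI →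
      ζ (msh (zw [1]) (zw v) - mul (zw [1]) (zw v)) = 0)
    -- (ii) the sum formula
    (hsum : ∀ k n : ℕ, 1 ≤ k → k + 1 ≤ n →
      ∑ c ∈ Finset.univ.filter
          (fun c : Composition n => c.length = k ∧ 2 ≤ c.blocks.headI),
        ζ (zw c.blocks) = ζ (zw [n])) :
    ∀ k n : ℕ, 2 ≤ k → k + 1 ≤ n →
      ∑ c ∈ Finset.univ.filter
          (fun c : Composition n => c.length = k ∧ 2 ≤ c.blocks.headI),
        (Ccoef (c.blocks.take (k - 1)) - Ccoef (c.blocks.tail.take (k - 2)))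
          • ζ (zw c.blocks)
      = (n : ℤ) • ζ (zw [n]) := by
  classical
  intro k n hk hn
  obtain ⟨k, rfl⟩ := Nat.exists_eq_add_of_le' (show 1 ≤ k by omega)
  have hk1 : 1 ≤ k := by omega
  have hzero : ζ (∑ p ∈ admissiblePairs k n,
      (msh (zw [p.1]) (zw p.2) - mul (zw [p.1]) (zw p.2))) = 0 := by
    rw [map_sum]
    refine Finset.sum_eq_zero ?_
    rintro ⟨r, w⟩ hp
    obtain ⟨hr, hw, h2, -⟩ := mem_admissiblePairs.1 hp
    rcases Nat.eq_or_lt_of_le hr with rfl | hr2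
    · exact hds1 w hw h2
    · exact hds [r] w (by simpa using hr) hw hr2 h2
  rw [sum_doubleShuffle mul hunitl hunitr hrec sh hsunitl hsunitr hsrec msh hsupp hcompat hk1,
    map_sub, map_smul, map_sum, map_sum] at hzero
  simp only [map_smul, map_sub, sub_smul _ ((k : ℤ) + 1), Finset.sum_sub_distrib, ← Finset.smul_sum]
    at hzero
  rw [sum_admissibleWords (k + 1) n fun l => ζ (zw l), sum_admissibleWords k n fun l => ζ (zw l),
    hsum (k + 1) n (by omega) hn, hsum k n hk1 (by omega), sum_admissibleWords, sub_sub,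
    add_sub_cancel, sub_eq_zero] at hzero
  exact hzero
end

section
/- For real multiple zeta values: for every integer n ≥ 3, ∑_{i=2}^{n-1} (2^i − 1) ζ(i, n−i) = n ζ(n), where ζ(s1, s2) = ∑_{n1 > n2 ≥ 1} 1/(n1^{s1} n2^{s2}) and ζ(n) is the Riemann zeta value. -/
/-- The Riemann zeta value `ζ(n) = ∑_{m ≥ 1} m^{-n}` as a real number. -/
noncomputable def zetaValue (n : ℕ) : ℝ := ∑' m : ℕ, 1 / ((m : ℝ) + 1) ^ n

/-- The double zeta value `ζ(s₁, s₂) = ∑_{n₁ > n₂ ≥ 1} n₁^{-s₁} n₂^{-s₂}`. -/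
noncomputable def doubleZetaValue (s₁ s₂ : ℕ) : ℝ :=
  ∑' p : {p : ℕ × ℕ // p.2 < p.1 ∧ 1 ≤ p.2},
    1 / (((p : ℕ × ℕ).1 : ℝ) ^ s₁ * ((p : ℕ × ℕ).2 : ℝ) ^ s₂)

/-- The reciprocals of the positive integers, indexed from `0`. -/
noncomputable def recipSucc (k : ℕ) : ℝ := ((k : ℝ) + 1)⁻¹

lemma recipSucc_pos (k : ℕ) : 0 < recipSucc k := by unfold recipSucc; positivity

lemma recipSucc_antitone {j k : ℕ} (h : j ≤ k) : recipSucc k ≤ recipSucc j := by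
  unfold recipSucc; gcongr

lemma recipSucc_le_one (k : ℕ) : recipSucc k ≤ 1 := by
  simpa [recipSucc] using recipSucc_antitone (Nat.zero_le k)

lemma recipSucc_mul_recipSucc (j k : ℕ) :
    recipSucc j * recipSucc k = recipSucc (j + k + 1) * (recipSucc j + recipSucc k) := by
  unfold recipSucc; push_cast; field_simp; ring

/-- A sum over pairs splits into its diagonal and its two strict triangles. -/
lemma hasSum_of_diagonal_of_triangles {f : ℕ × ℕ → ℝ} {A B C : ℝ}
    (hA : HasSum (fun m => f (m, m)) A)
    (hB : HasSum (fun p : ℕ × ℕ => f (p.1 + p.2 + 1, p.2)) B)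
    (hC : HasSum (fun p : ℕ × ℕ => f (p.2, p.1 + p.2 + 1)) C) :
    HasSum f (A + (B + C)) := by
  let g : ℕ ⊕ (ℕ × ℕ ⊕ ℕ × ℕ) → ℕ × ℕ :=
    Sum.elim (fun m => (m, m))
      (Sum.elim (fun p => (p.1 + p.2 + 1, p.2)) (fun p => (p.2, p.1 + p.2 + 1)))
  have hg : Function.Bijective g := by
    constructor
    · rintro (a | ⟨a, b⟩ | ⟨a, b⟩) (c | ⟨c, d⟩ | ⟨c, d⟩) h <;>
        simp [g] at h ⊢ <;> omega
    · rintro ⟨m, k⟩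
      rcases lt_trichotomy m k with h | h | h
      · exact ⟨Sum.inr (Sum.inr (k - m - 1, m)), by simp [g]; omega⟩
      · exact ⟨Sum.inl m, by simp [g, h]⟩
      · exact ⟨Sum.inr (Sum.inl (m - k - 1, k)), by simp [g]; omega⟩
  rw [← (Equiv.ofBijective g hg).hasSum_iff]
  exact HasSum.sum hA (HasSum.sum hB hC)

lemma summable_recipSucc_mul_sqrt : Summable fun k => recipSucc k * √(recipSucc k) := by
  have h := (summable_nat_add_iff 1).2 (Real.summable_nat_rpow_inv.2 (by norm_num : (1 : ℝ) < 3 / 2))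
  refine h.congr fun k => ?_
  have hk : (0 : ℝ) < k + 1 := by positivity
  rw [recipSucc, Real.sqrt_inv, ← mul_inv, Real.sqrt_eq_rpow]
  congr 1
  push_cast
  conv_rhs => rw [← Real.rpow_one_add' hk.le (by norm_num)]
  norm_num

lemma summable_recipSucc_pow_mul_pow {i j : ℕ} (hi : 2 ≤ i) (hj : 1 ≤ j) :
    Summable fun p : ℕ × ℕ => recipSucc (p.1 + p.2 + 1) ^ i * recipSucc p.2 ^ j := by
  refine Summable.of_nonneg_of_le (fun p => ?_) (fun p => ?_)
    (summable_recipSucc_mul_sqrt.mul_of_nonneg summable_recipSucc_mul_sqrt ?_ ?_)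
  · have := recipSucc_pos (p.1 + p.2 + 1)
    have := recipSucc_pos p.2
    positivity
  · have hx := recipSucc_pos p.1
    have hy := recipSucc_pos p.2
    have hz := recipSucc_pos (p.1 + p.2 + 1)
    have hzx : recipSucc (p.1 + p.2 + 1) ≤ recipSucc p.1 := recipSucc_antitone (by omega)
    have hzy : recipSucc (p.1 + p.2 + 1) ≤ recipSucc p.2 := recipSucc_antitone (by omega)
    have hs : recipSucc (p.1 + p.2 + 1) ≤ √(recipSucc p.1) * √(recipSucc p.2) := by
      rw [← Real.sqrt_mul hx.le]
      exact Real.le_sqrt_of_sq_le (by nlinarith)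
    calc recipSucc (p.1 + p.2 + 1) ^ i * recipSucc p.2 ^ j
        ≤ recipSucc (p.1 + p.2 + 1) ^ 2 * recipSucc p.2 ^ 1 := by
          gcongr ?_ * ?_
          · exact pow_le_pow_of_le_one hz.le (recipSucc_le_one _) hi
          · exact pow_le_pow_of_le_one hy.le (recipSucc_le_one _) hj
      _ = recipSucc (p.1 + p.2 + 1) * recipSucc (p.1 + p.2 + 1) * recipSucc p.2 := by ring
      _ ≤ recipSucc p.1 * (√(recipSucc p.1) * √(recipSucc p.2)) * recipSucc p.2 := by gcongr
      _ = _ := by ring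
  all_goals
    intro k
    have := recipSucc_pos k
    simp only [Pi.zero_apply]
    positivity

/-- Pairs of naturals `(a, b)` parametrise the pairs `n₁ > n₂ ≥ 1` by
`n₁ = a + b + 2`, `n₂ = b + 1`. -/
def strictPairEquiv : ℕ × ℕ ≃ {p : ℕ × ℕ // p.2 < p.1 ∧ 1 ≤ p.2} where
  toFun p := ⟨(p.1 + p.2 + 2, p.2 + 1), by simp only; omega⟩
  invFun p := (p.1.1 - p.1.2 - 1, p.1.2 - 1)
  left_inv p := by ext <;> simp; omega
  right_inv p := by
    obtain ⟨⟨a, b⟩, h⟩ := p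
    ext <;> simp at h ⊢ <;> omega

lemma hasSum_doubleZetaValue {i j : ℕ} (hi : 2 ≤ i) (hj : 1 ≤ j) :
    HasSum (fun p : ℕ × ℕ => recipSucc (p.1 + p.2 + 1) ^ i * recipSucc p.2 ^ j)
      (doubleZetaValue i j) := by
  convert (summable_recipSucc_pow_mul_pow hi hj).hasSum using 1
  rw [doubleZetaValue, ← strictPairEquiv.tsum_eq]
  refine tsum_congr fun p => ?_
  simp only [strictPairEquiv, Equiv.coe_fn_mk, recipSucc]
  push_cast
  rw [inv_pow, inv_pow, one_div, mul_inv]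
  ring_nf

lemma hasSum_doubleZetaValue_swap {i j : ℕ} (hi : 2 ≤ i) (hj : 1 ≤ j) :
    HasSum (fun p : ℕ × ℕ => recipSucc (p.1 + p.2 + 1) ^ i * recipSucc p.1 ^ j)
      (doubleZetaValue i j) := by
  rw [← (Equiv.prodComm ℕ ℕ).hasSum_iff]
  convert hasSum_doubleZetaValue hi hj using 2 with p
  simp [add_comm]

lemma hasSum_zetaValue {n : ℕ} (hn : 2 ≤ n) :
    HasSum (fun m => recipSucc m ^ n) (zetaValue n) := by
  have h : Summable fun m : ℕ => 1 / ((m : ℝ) + 1) ^ n := by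
    simpa using (summable_nat_add_iff 1).2 (Real.summable_one_div_nat_pow.2 hn)
  simpa [recipSucc, zetaValue] using h.hasSum

/-- The stuffle relation. -/
lemma hasSum_recipSucc_pow_mul_recipSucc_pow {r s : ℕ} (hr : 2 ≤ r) (hs : 2 ≤ s) :
    HasSum (fun p : ℕ × ℕ => recipSucc p.1 ^ r * recipSucc p.2 ^ s)
      (zetaValue (r + s) + (doubleZetaValue r s + doubleZetaValue s r)) := by
  apply hasSum_of_diagonal_of_triangles
  · simpa only [← pow_add] using hasSum_zetaValue (by omega : 2 ≤ r + s)
  · exact hasSum_doubleZetaValue hr (by omega)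
  · simpa only [mul_comm] using hasSum_doubleZetaValue hs (by omega : 1 ≤ r)

lemma hasSum_recipSucc_sub (b : ℕ) :
    HasSum (fun a => recipSucc a - recipSucc (a + b + 1))
      (∑ c ∈ Finset.range (b + 1), recipSucc c) := by
  have step (d : ℕ) : HasSum (fun a => recipSucc (a + d) - recipSucc (a + d + 1))
      (recipSucc d) := by
    rw [hasSum_iff_tendsto_nat_of_nonneg
      (fun a => sub_nonneg.2 (recipSucc_antitone (Nat.le_succ _)))]
    have h (N : ℕ) : ∑ a ∈ Finset.range N, (recipSucc (a + d) - recipSucc (a + d + 1))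
        = recipSucc d - recipSucc (N + d) := by
      have := Finset.sum_range_sub' (fun a => recipSucc (a + d)) N
      simpa [add_right_comm] using this
    simp only [h]
    have h0 : Filter.Tendsto recipSucc Filter.atTop (nhds 0) := by
      refine (tendsto_one_div_add_atTop_nhds_zero_nat (𝕜 := ℝ)).congr fun k => ?_
      rw [recipSucc, one_div]
    simpa using tendsto_const_nhds.sub (h0.comp (Filter.tendsto_add_atTop_nat d))
  convert hasSum_sum (s := Finset.range (b + 1)) (fun d _ => step d) using 2 with a
  exact (Finset.sum_range_sub' (fun d => recipSucc (a + d)) (b + 1)).symm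

lemma sum_range_pow_mul_pow_add {x y z : ℝ} (h : x * y = z * (x + y)) (k : ℕ) :
    ∑ l ∈ Finset.range k, z ^ (l + 2) * y ^ (k - l) + z ^ (k + 1) * x = x * z * y ^ k := by
  induction k with
  | zero => simp; ring
  | succ k ih =>
    have hshift : ∑ l ∈ Finset.range k, z ^ (l + 2) * y ^ (k + 1 - l)
        = y * ∑ l ∈ Finset.range k, z ^ (l + 2) * y ^ (k - l) := by
      rw [Finset.mul_sum]
      refine Finset.sum_congr rfl fun l hl => ?_
      rw [Nat.sub_add_comm (Finset.mem_range.1 hl).le]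
      ring
    rw [Finset.sum_range_succ, hshift, Nat.add_sub_cancel_left]
    linear_combination y * ih - z ^ (k + 1) * h

/-- The partial fraction identity behind the sum over `r` of the shuffle relations for
`ζ(r) ζ(n - r)`. -/
lemma sum_range_pow_mul_pow_add_eq_weighted {x y z : ℝ} (h : x * y = z * (x + y)) (m : ℕ) :
    ∑ l ∈ Finset.range m, x ^ (l + 2) * y ^ (m + 1 - l) + (z ^ (m + 2) * x + z ^ (m + 2) * y)
      = ∑ l ∈ Finset.range (m + 1),
          (2 ^ (l + 1) - 1) * (z ^ (l + 2) * y ^ (m + 1 - l) + z ^ (l + 2) * x ^ (m + 1 - l)) := by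
  induction m with
  | zero => simp; ring
  | succ m ih =>
    have hQ : ∑ l ∈ Finset.range (m + 1), x ^ (l + 2) * y ^ (m + 1 + 1 - l)
        = 2 * z * ∑ l ∈ Finset.range m, x ^ (l + 2) * y ^ (m + 1 - l)
          + z * (x ^ (m + 2) * y + x * y ^ (m + 2)) := by
      have h1 : ∑ l ∈ Finset.range (m + 1), x ^ (l + 2) * y ^ (m + 1 + 1 - l)
          = z * ∑ l ∈ Finset.range (m + 1), x ^ (l + 2) * y ^ (m + 1 - l)
            + z * ∑ l ∈ Finset.range (m + 1), x ^ (l + 1) * y ^ (m + 2 - l) := by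
        rw [Finset.mul_sum, Finset.mul_sum, ← Finset.sum_add_distrib]
        refine Finset.sum_congr rfl fun l hl => ?_
        obtain ⟨d, rfl⟩ := Nat.exists_eq_add_of_le (Nat.lt_succ_iff.1 (Finset.mem_range.1 hl))
        rw [show l + d + 1 + 1 - l = d + 2 by omega, show l + d + 1 - l = d + 1 by omega]
        linear_combination x ^ (l + 1) * y ^ (d + 1) * h
      have h2 : ∑ l ∈ Finset.range (m + 1), x ^ (l + 1) * y ^ (m + 2 - l)
          = ∑ l ∈ Finset.range m, x ^ (l + 2) * y ^ (m + 1 - l) + x * y ^ (m + 2) := by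
        simp [Finset.sum_range_succ']
      rw [h1, h2, Finset.sum_range_succ, Nat.add_sub_cancel_left]
      ring
    have hR : ∑ l ∈ Finset.range (m + 1 + 1), (2 ^ (l + 1) - 1) *
          (z ^ (l + 2) * y ^ (m + 1 + 1 - l) + z ^ (l + 2) * x ^ (m + 1 + 1 - l))
        = 2 * z * ∑ l ∈ Finset.range (m + 1),
            (2 ^ (l + 1) - 1) * (z ^ (l + 2) * y ^ (m + 1 - l) + z ^ (l + 2) * x ^ (m + 1 - l))
          + z * (∑ l ∈ Finset.range (m + 1), z ^ (l + 2) * y ^ (m + 1 - l)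
            + ∑ l ∈ Finset.range (m + 1), z ^ (l + 2) * x ^ (m + 1 - l))
          + z ^ 2 * (x ^ (m + 2) + y ^ (m + 2)) := by
      rw [Finset.sum_range_succ', ← Finset.sum_add_distrib, Finset.mul_sum, Finset.mul_sum,
        ← Finset.sum_add_distrib]
      congr 1
      · refine Finset.sum_congr rfl fun l _ => ?_
        rw [Nat.add_sub_add_right]
        ring
      · simp only [Nat.sub_zero]
        ring
    rw [hQ, hR]
    have hy := sum_range_pow_mul_pow_add h (m + 1)
    have hx := sum_range_pow_mul_pow_add (x := y) (y := x) (z := z) (by linarith) (m + 1)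
    linear_combination 2 * z * ih - z * hx - z * hy + z * (x ^ (m + 1) + y ^ (m + 1)) * h

lemma hasSum_recipSucc_pow_mul_sum {k : ℕ} (hk : 1 ≤ k) :
    HasSum (fun b => recipSucc b ^ (k + 1) * ∑ c ∈ Finset.range (b + 1), recipSucc c)
      (zetaValue (k + 2) + doubleZetaValue (k + 1) 1) := by
  have key : HasSum (fun p : ℕ × ℕ =>
      if p.2 ≤ p.1 then recipSucc p.1 ^ (k + 1) * recipSucc p.2 else 0)
      (zetaValue (k + 2) + (doubleZetaValue (k + 1) 1 + 0)) := by
    apply hasSum_of_diagonal_of_triangles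
    · simpa only [le_refl, if_true, ← pow_succ] using hasSum_zetaValue (by omega : 2 ≤ k + 2)
    · convert hasSum_doubleZetaValue (by omega : 2 ≤ k + 1) le_rfl using 2 with p
      rw [if_pos (by simp only; omega), pow_one]
    · convert hasSum_zero using 2 with p
      rw [if_neg (by simp only; omega)]
  rw [add_zero] at key
  refine key.prod_fiberwise fun b => ?_
  rw [Finset.mul_sum]
  convert hasSum_sum_of_ne_finset_zero (s := Finset.range (b + 1))
    (L := SummationFilter.unconditional ℕ) ?_ using 1
  · refine Finset.sum_congr rfl fun c hc => ?_
    rw [if_pos (Nat.lt_succ_iff.1 (Finset.mem_range.1 hc))]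
  · intro c hc
    rw [if_neg fun h => hc (Finset.mem_range.2 (Nat.lt_succ_iff.2 h))]

/-- Euler's sum formula. -/
lemma sum_doubleZetaValue {k : ℕ} (hk : 1 ≤ k) :
    ∑ l ∈ Finset.range k, doubleZetaValue (l + 2) (k - l) = zetaValue (k + 2) := by
  have h1 := (hasSum_sum (s := Finset.range k) fun l hl =>
      hasSum_doubleZetaValue (i := l + 2) (j := k - l) (by omega)
        (by have := Finset.mem_range.1 hl; omega)).add
    (hasSum_doubleZetaValue_swap (i := k + 1) (j := 1) (by omega) le_rfl)
  simp only [pow_one, sum_range_pow_mul_pow_add (recipSucc_mul_recipSucc _ _)] at h1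
  rw [← (Equiv.prodComm ℕ ℕ).hasSum_iff] at h1
  have h2 := h1.prod_fiberwise (g := fun b =>
      recipSucc b ^ (k + 1) * ∑ c ∈ Finset.range (b + 1), recipSucc c) fun b => by
    have hfiber (a : ℕ) : recipSucc a * recipSucc (a + b + 1) * recipSucc b ^ k
        = recipSucc b ^ (k + 1) * (recipSucc a - recipSucc (a + b + 1)) := by
      linear_combination -recipSucc b ^ k * recipSucc_mul_recipSucc a b
    simpa only [Function.comp_apply, Equiv.prodComm_apply, Prod.swap_prod_mk, Prod.fst_swap,
      Prod.snd_swap, hfiber] using (hasSum_recipSucc_sub b).mul_left (recipSucc b ^ (k + 1))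
  linarith [h2.unique (hasSum_recipSucc_pow_mul_sum hk)]

/-- The sum over `r` of the double shuffle relations for `ζ(r) ζ(m + 3 - r)`. -/
lemma sum_double_shuffle (m : ℕ) :
    ∑ l ∈ Finset.range m, (zetaValue (m + 3) +
        (doubleZetaValue (l + 2) (m + 1 - l) + doubleZetaValue (m + 1 - l) (l + 2)))
        + 2 * doubleZetaValue (m + 2) 1
      = 2 * ∑ l ∈ Finset.range (m + 1),
          (2 ^ (l + 1) - 1) * doubleZetaValue (l + 2) (m + 1 - l) := by
  have hL := (hasSum_sum (s := Finset.range m) fun l hl =>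
      hasSum_recipSucc_pow_mul_recipSucc_pow (r := l + 2) (s := m + 1 - l) (by omega)
        (by have := Finset.mem_range.1 hl; omega)).add
    ((hasSum_doubleZetaValue_swap (i := m + 2) (j := 1) (by omega) le_rfl).add
      (hasSum_doubleZetaValue (i := m + 2) (j := 1) (by omega) le_rfl))
  have hR := hasSum_sum (s := Finset.range (m + 1)) fun l hl =>
    ((hasSum_doubleZetaValue (i := l + 2) (j := m + 1 - l) (by omega)
        (by have := Finset.mem_range.1 hl; omega)).add
      (hasSum_doubleZetaValue_swap (i := l + 2) (j := m + 1 - l) (by omega)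
        (by have := Finset.mem_range.1 hl; omega))).mul_left ((2 : ℝ) ^ (l + 1) - 1)
  simp only [pow_one,
    sum_range_pow_mul_pow_add_eq_weighted (recipSucc_mul_recipSucc _ _)] at hL
  have hLR := hL.unique hR
  have hw : ∀ l ∈ Finset.range m, zetaValue (l + 2 + (m + 1 - l)) = zetaValue (m + 3) := by
    intro l hl
    have := Finset.mem_range.1 hl
    congr 1
    omega
  rw [Finset.sum_congr rfl fun l hl => by rw [← hw l hl], two_mul (doubleZetaValue _ _), hLR,
    Finset.mul_sum]
  exact Finset.sum_congr rfl fun l _ => by ring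

/-- The weighted Euler sum formula: for `n ≥ 3`,
`∑_{i=2}^{n-1} (2^i − 1) ζ(i, n−i) = n ζ(n)`. -/
theorem weighted_euler_sum_formula (n : ℕ) (hn : 3 ≤ n) :
    ∑ i ∈ Finset.Icc 2 (n - 1), ((2 : ℝ) ^ i - 1) * doubleZetaValue i (n - i)
      = (n : ℝ) * zetaValue n := by
  obtain ⟨m, rfl⟩ := Nat.exists_eq_add_of_le' hn
  have hindex : ∑ i ∈ Finset.Icc 2 (m + 3 - 1), ((2 : ℝ) ^ i - 1) * doubleZetaValue i (m + 3 - i)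
      = ∑ l ∈ Finset.range (m + 1),
          ((2 : ℝ) ^ (l + 2) - 1) * doubleZetaValue (l + 2) (m + 1 - l) := by
    rw [show Finset.Icc 2 (m + 3 - 1) = Finset.Ico 2 (m + 3) by ext; simp; omega,
      Finset.sum_Ico_eq_sum_range]
    refine Finset.sum_congr (by congr 1) fun l _ => ?_
    rw [add_comm 2 l, show m + 3 - (l + 2) = m + 1 - l by omega]
  have hweight : ∑ l ∈ Finset.range (m + 1),
        ((2 : ℝ) ^ (l + 2) - 1) * doubleZetaValue (l + 2) (m + 1 - l)
      = 2 * ∑ l ∈ Finset.range (m + 1),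
          (2 ^ (l + 1) - 1) * doubleZetaValue (l + 2) (m + 1 - l)
        + ∑ l ∈ Finset.range (m + 1), doubleZetaValue (l + 2) (m + 1 - l) := by
    rw [Finset.mul_sum, ← Finset.sum_add_distrib]
    exact Finset.sum_congr rfl fun l _ => by ring
  have hreflect : ∑ l ∈ Finset.range m, doubleZetaValue (m + 1 - l) (l + 2)
      = ∑ l ∈ Finset.range m, doubleZetaValue (l + 2) (m + 1 - l) := by
    rw [← Finset.sum_range_reflect]
    refine Finset.sum_congr rfl fun l hl => ?_
    have := Finset.mem_range.1 hl
    congr 1 <;> omega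
  have heuler := sum_doubleZetaValue (by omega : 1 ≤ m + 1)
  have hsplit := heuler
  rw [Finset.sum_range_succ, Nat.add_sub_cancel_left] at hsplit
  have hshuffle := sum_double_shuffle m
  rw [Finset.sum_add_distrib, Finset.sum_add_distrib, hreflect, Finset.sum_const,
    Finset.card_range, nsmul_eq_mul] at hshuffle
  rw [hindex, hweight, heuler, ← hshuffle]
  push_cast
  linear_combination 2 * hsplit
end
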